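/- arXiv:2409.02755 — 6 statements merged into one kernel-verified Lean document; each statement's English description precedes it below -/
import Mathlib

section
/- Let ω, b ∈ ℝ satisfy one of the following: (i) ω ≥ 1 and b < 0; (ii) −1 < ω < 1 and b < (1−ω)² with b ≠ 0; (iii) ω ≤ −1 and b < (1−ω)² with b ≠ (1+ω)². Then there exist L > 0 and a nonconstant continuously differentiable solution (θ, ξ) : ℝ → ℝ² of the planar system ξ' = 2ξ sin θ, θ' = 2ω + 2ξ + 2cos θ such that ξ(x) > 0 for all x, ξ(x + L) = ξ(x) for all x, and −2ωξ(x) − ξ(x)² − 2ξ(x) cos θ(x) = b for all x. Moreover, if ω < −1 and 0 < b < (1+ω)², there exist two such solutions whose ranges of ξ are disjoint. -/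
/-- A nonconstant, continuously differentiable, positive, `L`-periodic solution of the
planar system `ξ' = 2ξ sin θ`, `θ' = 2ω + 2ξ + 2 cos θ` on the level set
`−2ωξ − ξ² − 2ξ cos θ = b`. -/
def IsStandingPeriodicSolution (ω b L : ℝ) (θ ξ : ℝ → ℝ) : Prop :=
  ContDiff ℝ 1 θ ∧ ContDiff ℝ 1 ξ ∧
  (∀ x, deriv ξ x = 2 * ξ x * Real.sin (θ x)) ∧
  (∀ x, deriv θ x = 2 * ω + 2 * ξ x + 2 * Real.cos (θ x)) ∧
  (∀ x, 0 < ξ x) ∧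
  (∀ x, ξ (x + L) = ξ x) ∧
  (∀ x, -2 * ω * ξ x - ξ x ^ 2 - 2 * ξ x * Real.cos (θ x) = b) ∧
  (∃ x y, (θ x, ξ x) ≠ (θ y, ξ y))

open Real

/-- The defining conditions follow from pointwise derivatives; `C¹` regularity is automatic. -/
theorem IsStandingPeriodicSolution.of_hasDerivAt {ω b L : ℝ} {θ ξ : ℝ → ℝ}
    (hξ : ∀ x, HasDerivAt ξ (2 * ξ x * sin (θ x)) x)
    (hθ : ∀ x, HasDerivAt θ (2 * ω + 2 * ξ x + 2 * cos (θ x)) x)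
    (hpos : ∀ x, 0 < ξ x) (hper : ∀ x, ξ (x + L) = ξ x)
    (hb : ∀ x, -2 * ω * ξ x - ξ x ^ 2 - 2 * ξ x * cos (θ x) = b)
    (hne : ∃ x y, (θ x, ξ x) ≠ (θ y, ξ y)) :
    IsStandingPeriodicSolution ω b L θ ξ := by
  have cξ : Continuous ξ := continuous_iff_continuousAt.2 fun x => (hξ x).continuousAt
  have cθ : Continuous θ := continuous_iff_continuousAt.2 fun x => (hθ x).continuousAt
  have dξ : deriv ξ = fun x => 2 * ξ x * sin (θ x) := funext fun x => (hξ x).deriv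
  have dθ : deriv θ = fun x => 2 * ω + 2 * ξ x + 2 * cos (θ x) :=
    funext fun x => (hθ x).deriv
  refine ⟨contDiff_one_iff_deriv.2 ⟨fun x => (hθ x).differentiableAt, ?_⟩,
    contDiff_one_iff_deriv.2 ⟨fun x => (hξ x).differentiableAt, ?_⟩,
    fun x => (hξ x).deriv, fun x => (hθ x).deriv, hpos, hper, hb, hne⟩
  · rw [dθ]; fun_prop
  · rw [dξ]; fun_prop

/-- A scalar autonomous equation `φ' = F φ` with `F` continuous, positive and `2π`-periodic has
a global, surjective solution that advances by `2π` in a fixed time. -/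
theorem exists_rotating_solution {F : ℝ → ℝ} (hF : Continuous F) (hpos : ∀ y, 0 < F y)
    (hper : Function.Periodic F (2 * π)) :
    ∃ L : ℝ, 0 < L ∧ ∃ φ : ℝ → ℝ, (∀ x, HasDerivAt φ (F (φ x)) x) ∧
      (∀ x, φ (x + L) = φ x + 2 * π) ∧ Function.Surjective φ := by
  have hG : Continuous fun y => (F y)⁻¹ := hF.inv₀ fun y => (hpos y).ne'
  have hGper : Function.Periodic (fun y => (F y)⁻¹) (2 * π) := fun y => by
    simp only [hper y]
  have hint : ∀ a c, IntervalIntegrable (fun y => (F y)⁻¹) MeasureTheory.volume a c :=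
    fun a c => hG.intervalIntegrable a c
  let H : ℝ → ℝ := fun y => ∫ t in (0 : ℝ)..y, (F t)⁻¹
  have hH : ∀ y, HasDerivAt H (F y)⁻¹ y := fun y =>
    intervalIntegral.integral_hasDerivAt_right (hint 0 y)
      (hG.stronglyMeasurableAtFilter _ _) hG.continuousAt
  have hHc : Continuous H := continuous_iff_continuousAt.2 fun y => (hH y).continuousAt
  have hHmono : StrictMono H := strictMono_of_deriv_pos fun y => by
    rw [(hH y).deriv]; exact inv_pos.2 (hpos y)
  have h2 : (0 : ℝ) < 2 * π := by positivity
  have hGpos : 0 < ∫ t in (0 : ℝ)..(2 * π), (F t)⁻¹ :=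
    intervalIntegral.intervalIntegral_pos_of_pos (hint _ _) (fun y => inv_pos.2 (hpos y)) h2
  have hHsurj : Function.Surjective H :=
    hHc.surjective
      (hGper.tendsto_atTop_intervalIntegral_of_pos' (hint _ _) (fun y => inv_pos.2 (hpos y)) h2)
      (hGper.tendsto_atBot_intervalIntegral_of_pos' (hint _ _) (fun y => inv_pos.2 (hpos y)) h2)
  let e : ℝ ≃o ℝ := hHmono.orderIsoOfSurjective H hHsurj
  have heH : ∀ y, e y = H y := fun _ => rfl
  have hHe : ∀ x, H (e.symm x) = x := fun x => by rw [← heH, e.apply_symm_apply]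
  have hadd : ∀ y, H (y + 2 * π) = H y + H (2 * π) := fun y => by
    have h1 := hGper.intervalIntegral_add_eq 0 y
    have h3 := intervalIntegral.integral_add_adjacent_intervals (hint 0 y) (hint y (y + 2 * π))
    simp only [zero_add] at h1
    simp only [H]
    linarith
  refine ⟨H (2 * π), hGpos, e.symm, fun x => ?_, fun x => ?_, e.symm.surjective⟩
  · have := (hH (e.symm x)).of_local_left_inverse e.symm.continuous.continuousAt
      (inv_ne_zero (hpos _).ne') (Filter.Eventually.of_forall hHe)
    simpa using this
  · apply hHmono.injective
    rw [hHe, hadd, hHe]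

/-- Waves along which `θ` rotates, in the direction given by the sign `s`. -/
theorem exists_rotating_wave {ω b s : ℝ} (hs : s = 1 ∨ s = -1)
    (hb : ∀ t, b < (ω + cos t) ^ 2)
    (hpos : ∀ t, 0 < s * √((ω + cos t) ^ 2 - b) - (ω + cos t)) :
    ∃ L : ℝ, 0 < L ∧ ∃ θ ξ : ℝ → ℝ, IsStandingPeriodicSolution ω b L θ ξ ∧
      ∀ x, ξ x = s * √((ω + cos (θ x)) ^ 2 - b) - (ω + cos (θ x)) := by
  obtain ⟨L, hL, φ, hφ, hφL, -⟩ :=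
    exists_rotating_solution (F := fun t => 2 * √((ω + cos t) ^ 2 - b)) (by fun_prop)
      (fun t => mul_pos two_pos (sqrt_pos.2 (sub_pos.2 (hb t))))
      (fun t => by simp only [cos_add_two_pi])
  have hs2 : s * s = 1 := by rcases hs with rfl | rfl <;> norm_num
  have hθ : ∀ x, HasDerivAt (fun x => φ (s * x))
      (2 * s * √((ω + cos (φ (s * x))) ^ 2 - b)) x := fun x => by
    refine ((hφ (s * x)).comp x ((hasDerivAt_id x).const_mul s)).congr_deriv ?_
    ring
  refine ⟨L, hL, fun x => φ (s * x),
    fun x => s * √((ω + cos (φ (s * x))) ^ 2 - b) - (ω + cos (φ (s * x))),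
    .of_hasDerivAt (fun x => ?_) (fun x => ?_) (fun x => hpos _) (fun x => ?_) (fun x => ?_) ?_,
    fun x => rfl⟩
  · have hR := sqrt_pos.2 (sub_pos.2 (hb (φ (s * x))))
    have ha := (hθ x).cos.const_add ω
    refine ((((ha.pow 2).sub_const b).sqrt (sub_pos.2 (hb _)).ne').const_mul s).sub ha
      |>.congr_deriv ?_
    have hR1 := mul_inv_cancel₀ hR.ne'
    generalize √((ω + cos (φ (s * x))) ^ 2 - b) = R at *
    linear_combination -2 * sin (φ (s * x)) * (ω + cos (φ (s * x))) * (hs2 + s * s * hR1)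
  · refine (hθ x).congr_deriv ?_
    ring
  · have hc : cos (φ (s * (x + L))) = cos (φ (s * x)) := by
      rcases hs with rfl | rfl
      · rw [one_mul, one_mul, hφL, cos_add_two_pi]
      · rw [← cos_add_two_pi, ← hφL]
        congr 2
        ring
    simp only [hc]
  · have := sq_sqrt (sub_pos.2 (hb (φ (s * x)))).le
    linear_combination (-(√((ω + cos (φ (s * x))) ^ 2 - b) ^ 2)) * hs2 - this
  · refine ⟨s * L, 0, fun h => ?_⟩
    have h1 := (Prod.ext_iff.1 h).1
    have h3 := hφL 0
    simp only [← mul_assoc, hs2, one_mul, mul_zero, zero_add] at h1 h3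
    linarith [pi_pos]

/-- For `ω < -1` and `b < (1 + ω)²` there is a wave with amplitude above `-(1 + ω)`. -/
theorem exists_upper_wave {ω b : ℝ} (hω : ω < -1) (hb : b < (1 + ω) ^ 2) :
    ∃ L : ℝ, 0 < L ∧ ∃ θ ξ : ℝ → ℝ, IsStandingPeriodicSolution ω b L θ ξ ∧
      ∀ x, -(1 + ω) < ξ x := by
  have hlt : ∀ t, b < (ω + cos t) ^ 2 := fun t => by nlinarith [cos_le_one t]
  have hlow : ∀ t, -(1 + ω) < 1 * √((ω + cos t) ^ 2 - b) - (ω + cos t) := fun t => by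
    linarith [cos_le_one t, sqrt_pos.2 (sub_pos.2 (hlt t))]
  obtain ⟨L, hL, θ, ξ, hsol, hξ⟩ := exists_rotating_wave (.inl rfl) hlt
    fun t => lt_trans (by linarith) (hlow t)
  exact ⟨L, hL, θ, ξ, hsol, fun x => hξ x ▸ hlow _⟩

/-- For `ω < -1` and `0 < b < (1 + ω)²` there is a wave with amplitude below `-(1 + ω)`. -/
theorem exists_lower_wave {ω b : ℝ} (hω : ω < -1) (hb : 0 < b) (hb1 : b < (1 + ω) ^ 2) :
    ∃ L : ℝ, 0 < L ∧ ∃ θ ξ : ℝ → ℝ, IsStandingPeriodicSolution ω b L θ ξ ∧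
      ∀ x, ξ x < -(1 + ω) := by
  have hlt : ∀ t, b < (ω + cos t) ^ 2 := fun t => by nlinarith [cos_le_one t]
  have hpos : ∀ t, 0 < -1 * √((ω + cos t) ^ 2 - b) - (ω + cos t) := fun t => by
    have : √((ω + cos t) ^ 2 - b) < -(ω + cos t) :=
      (sqrt_lt' (by linarith [cos_le_one t])).2 (by linarith [neg_sq (ω + cos t)])
    linarith
  have hup : ∀ t, -1 * √((ω + cos t) ^ 2 - b) - (ω + cos t) < -(1 + ω) := fun t => by
    have : 1 - cos t < √((ω + cos t) ^ 2 - b) :=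
      lt_sqrt_of_sq_lt (by nlinarith [cos_le_one t])
    linarith
  obtain ⟨L, hL, θ, ξ, hsol, hξ⟩ := exists_rotating_wave (.inr rfl) hlt hpos
  exact ⟨L, hL, θ, ξ, hsol, fun x => hξ x ▸ hup _⟩

/-- Waves along which `θ` oscillates around `π`, parametrized by the angle `φ` with
`ξ = 1 - ω + r cos φ`. -/
theorem exists_librating_wave {ω b : ℝ} (hω : ω < 1) (hb : 0 < b) (hb1 : b < (1 - ω) ^ 2)
    (hb2 : -1 < ω ∨ (1 + ω) ^ 2 < b) :
    ∃ L : ℝ, 0 < L ∧ ∃ θ ξ : ℝ → ℝ, IsStandingPeriodicSolution ω b L θ ξ := by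
  obtain ⟨r, hr, hr2⟩ : ∃ r : ℝ, 0 < r ∧ r ^ 2 = (1 - ω) ^ 2 - b :=
    ⟨√((1 - ω) ^ 2 - b), sqrt_pos.2 (by linarith), sq_sqrt (by linarith)⟩
  have hr1 : r < 1 - ω := by nlinarith
  let X : ℝ → ℝ := fun t => 1 - ω + r * cos t
  have hX : ∀ t, 0 < X t := fun t => by
    have := neg_one_le_cos t
    simp only [X]
    nlinarith
  let G : ℝ → ℝ := fun t => X t ^ 2 + 2 * (1 + ω) * X t + b
  have hG : ∀ t, 0 < G t := fun t => by
    have := hX t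
    simp only [G]
    rcases hb2 with h | h
    · have : 0 < 1 + ω := by linarith
      positivity
    · nlinarith [sq_nonneg (X t + (1 + ω))]
  have hGX : ∀ t, G t = 4 * X t - r ^ 2 * sin t ^ 2 := fun t => by
    simp only [G, X]
    linear_combination r ^ 2 * sin_sq_add_cos_sq t + hr2
  obtain ⟨L, hL, φ, hφ, hφL, hφs⟩ :=
    exists_rotating_solution (F := fun t => √(G t)) (by fun_prop)
      (fun t => sqrt_pos.2 (hG t)) (fun t => by simp only [G, X, cos_add_two_pi])
  let u : ℝ → ℝ := fun t => -(r * sin t) / (2 * √(X t))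
  have hu : ∀ t, √(1 - u t ^ 2) = √(G t) / (2 * √(X t)) := fun t => by
    have h1 := sqrt_pos.2 (hX t)
    have h2 := sq_sqrt (hX t).le
    have : 1 - u t ^ 2 = G t / (2 * √(X t)) ^ 2 := by
      rw [hGX]
      simp only [u]
      field_simp
      rw [h2]
      ring
    rw [this, sqrt_div (hG t).le, sqrt_sq (by positivity)]
  have hu1 : ∀ t, u t ^ 2 < 1 := fun t => by
    have : 0 < √(1 - u t ^ 2) := by
      rw [hu]
      exact div_pos (sqrt_pos.2 (hG t)) (mul_pos two_pos (sqrt_pos.2 (hX t)))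
    linarith [sqrt_pos.1 this]
  have hu2 : ∀ t, -1 < u t ∧ u t < 1 := fun t => abs_lt.1 ((sq_lt_one_iff_abs_lt_one _).1 (hu1 t))
  have hsin : ∀ t, 2 * X t * sin (2 * arccos (u t)) = -(r * sin t) * √(G t) := fun t => by
    have h1 := sqrt_pos.2 (hX t)
    have h2 := sq_sqrt (hX t).le
    rw [sin_two_mul, sin_arccos, cos_arccos (hu2 t).1.le (hu2 t).2.le, hu]
    simp only [u]
    field_simp
    rw [h2]
    ring
  have hcos : ∀ t, 2 * X t * cos (2 * arccos (u t)) = 2 * X t - G t := fun t => by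
    have h1 := sqrt_pos.2 (hX t)
    have h2 := sq_sqrt (hX t).le
    rw [cos_two_mul, cos_arccos (hu2 t).1.le (hu2 t).2.le, hGX]
    simp only [u]
    field_simp
    rw [h2]
    ring
  have hξ : ∀ x, HasDerivAt (fun x => X (φ x)) (-(r * sin (φ x)) * √(G (φ x))) x := fun x => by
    refine (((hφ x).cos.const_mul r).const_add (1 - ω)).congr_deriv ?_
    ring
  refine ⟨L, hL, fun x => 2 * arccos (u (φ x)), fun x => X (φ x),
    .of_hasDerivAt (fun x => ?_) (fun x => ?_) (fun x => hX _) (fun x => ?_) (fun x => ?_) ?_⟩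
  · rw [hsin]
    exact hξ x
  · have h0 := hX (φ x)
    have h1 := sqrt_pos.2 h0
    have h2 := sq_sqrt h0.le
    have h3 := sqrt_pos.2 (hG (φ x))
    have hnum := ((hφ x).sin.const_mul r).neg
    have hden := ((hξ x).sqrt h0.ne').const_mul 2
    have hd := hnum.div hden (by positivity)
    refine (((hasDerivAt_arccos (hu2 (φ x)).1.ne' (hu2 (φ x)).2.ne).comp x hd).const_mul 2)
      |>.congr_deriv ?_
    rw [hu]
    have hc : 2 * cos (2 * arccos (u (φ x))) = 2 - G (φ x) / X (φ x) := by
      have := hcos (φ x)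
      field_simp
      linarith
    rw [hGX] at h3 hc ⊢
    rw [hc]
    have hXr : r * cos (φ x) = X (φ x) - (1 - ω) := by simp only [X]; ring
    simp only [Pi.neg_apply]
    field_simp
    rw [h2]
    linear_combination 2 * X (φ x) * hXr
  · simp only [X, hφL, cos_add_two_pi]
  · rw [hcos]
    simp only [G]
    ring
  · obtain ⟨x, hx⟩ := hφs 0
    obtain ⟨y, hy⟩ := hφs π
    refine ⟨x, y, fun h => ?_⟩
    have h1 := (Prod.ext_iff.1 h).2
    simp only [X, hx, hy, cos_zero, cos_pi] at h1
    linarith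

/-- existence of standing periodic waves in the regions
(i) ω ≥ 1, b < 0; (ii) −1 < ω < 1, b < (1−ω)², b ≠ 0;
(iii) ω ≤ −1, b < (1−ω)², b ≠ (1+ω)²; with two coexisting families whose
amplitude ranges are disjoint when ω < −1 and 0 < b < (1+ω)². -/
theorem mtm_existence_standing_periodic (ω b : ℝ)
    (h : (1 ≤ ω ∧ b < 0) ∨
         (-1 < ω ∧ ω < 1 ∧ b < (1 - ω) ^ 2 ∧ b ≠ 0) ∨
         (ω ≤ -1 ∧ b < (1 - ω) ^ 2 ∧ b ≠ (1 + ω) ^ 2)) :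
    (∃ L : ℝ, 0 < L ∧ ∃ θ ξ : ℝ → ℝ, IsStandingPeriodicSolution ω b L θ ξ) ∧
    (ω < -1 → 0 < b → b < (1 + ω) ^ 2 →
      ∃ L₁ L₂ : ℝ, 0 < L₁ ∧ 0 < L₂ ∧ ∃ θ₁ ξ₁ θ₂ ξ₂ : ℝ → ℝ,
        IsStandingPeriodicSolution ω b L₁ θ₁ ξ₁ ∧
        IsStandingPeriodicSolution ω b L₂ θ₂ ξ₂ ∧
        Disjoint (Set.range ξ₁) (Set.range ξ₂)) := by
  constructor
  · rcases lt_trichotomy b 0 with hb | rfl | hb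
    · obtain ⟨L, hL, θ, ξ, hsol, -⟩ := exists_rotating_wave (ω := ω) (b := b) (s := 1) (.inl rfl)
        (fun t => hb.trans_le (sq_nonneg _)) (fun t => by
          have : ω + cos t < √((ω + cos t) ^ 2 - b) := lt_sqrt_of_sq_lt (by linarith)
          linarith)
      exact ⟨L, hL, θ, ξ, hsol⟩
    · have hω : ω < -1 := by
        rcases h with h | h | ⟨h1, -, h3⟩
        · exact absurd h.2 (lt_irrefl _)
        · exact absurd rfl h.2.2.2
        · exact lt_of_le_of_ne h1 fun h => h3 (by rw [h]; norm_num)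
      obtain ⟨L, hL, θ, ξ, hsol, -⟩ := exists_upper_wave hω (by nlinarith : 0 < (1 + ω) ^ 2)
      exact ⟨L, hL, θ, ξ, hsol⟩
    · by_cases hlib : -1 < ω ∨ (1 + ω) ^ 2 < b
      · rcases h with h | h | h
        · linarith [h.2]
        · exact exists_librating_wave h.2.1 hb h.2.2.1 hlib
        · exact exists_librating_wave (by linarith [h.1]) hb h.2.1 hlib
      · push Not at hlib
        have hbne : b ≠ (1 + ω) ^ 2 := by
          rcases h with h | h | h
          · linarith [h.2]
          · linarith [h.1, hlib.1]
          · exact h.2.2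
        have hω : ω < -1 := lt_of_le_of_ne hlib.1 fun h => by
          have := hlib.2
          rw [h] at this
          linarith
        obtain ⟨L, hL, θ, ξ, hsol, -⟩ := exists_upper_wave hω (lt_of_le_of_ne hlib.2 hbne)
        exact ⟨L, hL, θ, ξ, hsol⟩
  · intro hω hb hb1
    obtain ⟨L₁, hL₁, θ₁, ξ₁, h₁, hξ₁⟩ := exists_upper_wave hω hb1
    obtain ⟨L₂, hL₂, θ₂, ξ₂, h₂, hξ₂⟩ := exists_lower_wave hω hb hb1
    refine ⟨L₁, L₂, hL₁, hL₂, θ₁, ξ₁, θ₂, ξ₂, h₁, h₂, Set.disjoint_left.2 ?_⟩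
    rintro _ ⟨x, rfl⟩ ⟨y, hy⟩
    linarith [hξ₁ x, hξ₂ y]
end

section
/- Define P by the factorization P(λ) = (1/(4λ⁴))(λ² − λ₁²)(λ² − λ₁⁻²)(λ² − λ₂²)(λ² − λ₂⁻²) for λ ∈ ℂ \ {0}, with parameters λ₁, λ₂ ∈ ℂ \ {0}. Then for λ = iβ with β ∈ ℝ \ {0}: (i) if ω := (λ₁² + λ₁⁻² + λ₂² + λ₂⁻²)/4 and b := ω² − (λ₁² + λ₁⁻²)(λ₂² + λ₂⁻²)/4 are real and P(iβ) ≠ 0 for all β ∈ ℝ \ {0}, then P(iβ) is real and strictly positive for all β ∈ ℝ \ {0}; (ii) if λ₁ = e^{iα₁} for some α₁ ∈ ℝ and λ₂ = iβ₂ with β₂ ≥ 1, then P(iβ) is real and P(iβ) ≥ 0 for every β ∈ ((−∞, −β₂] ∪ [−β₂⁻¹, β₂⁻¹] ∪ [β₂, ∞)) \ {0}; (iii) if λ₁ = iβ₁ and λ₂ = iβ₂ with β₁ ≥ β₂ ≥ 1, then P(iβ) is real and P(iβ) ≥ 0 for every β ∈ ((−∞, −β₁] ∪ [−β₂, −β₂⁻¹]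 ∪ [−β₁⁻¹, β₁⁻¹] ∪ [β₂⁻¹, β₂] ∪ [β₁, ∞)) \ {0}. In each case Λ = ±i√(P(iβ)) is purely imaginary for the stated β. -/
open Complex

/-- The factorized characteristic function
`P(λ) = (1/(4λ⁴))(λ² − λ₁²)(λ² − λ₁⁻²)(λ² − λ₂²)(λ² − λ₂⁻²)`. -/
noncomputable def Pfac (lam₁ lam₂ lam : ℂ) : ℂ :=
  1 / (4 * lam ^ 4) *
    ((lam ^ 2 - lam₁ ^ 2) * (lam ^ 2 - lam₁⁻¹ ^ 2) *
      (lam ^ 2 - lam₂ ^ 2) * (lam ^ 2 - lam₂⁻¹ ^ 2))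

/-- An even function of `x`, invariant under `x ↦ x⁻¹`, through which `P(ix)` depends on `x`. -/
noncomputable def sqAddInvSq (x : ℝ) : ℝ := x ^ 2 + x⁻¹ ^ 2

lemma sqAddInvSq_inv (x : ℝ) : sqAddInvSq x⁻¹ = sqAddInvSq x := by
  simp [sqAddInvSq, add_comm]

lemma sqAddInvSq_le_of_abs_le {x y : ℝ} (hxy : |x| ≤ |y|) (h : 1 ≤ |x| * |y|) :
    sqAddInvSq x ≤ sqAddInvSq y := by
  have hx : x ≠ 0 := by
    rintro rfl
    norm_num at h
  have hy : y ≠ 0 := by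
    rintro rfl
    norm_num at h
  have hsq : x ^ 2 ≤ y ^ 2 := sq_le_sq.mpr hxy
  have hprod : 1 ≤ (x * y) ^ 2 := by
    rw [← sq_abs, abs_mul]
    nlinarith
  have key : sqAddInvSq y - sqAddInvSq x
      = (y ^ 2 - x ^ 2) * ((x * y) ^ 2 - 1) / (x * y) ^ 2 := by
    unfold sqAddInvSq
    field_simp
    ring
  have : 0 ≤ sqAddInvSq y - sqAddInvSq x := by
    rw [key]
    exact div_nonneg (mul_nonneg (sub_nonneg.mpr hsq) (sub_nonneg.mpr hprod)) (sq_nonneg _)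
  linarith

lemma sqAddInvSq_le_of_le_abs {a x : ℝ} (ha : 1 ≤ a) (h : a ≤ |x|) :
    sqAddInvSq a ≤ sqAddInvSq x := by
  have ha' : |a| = a := abs_of_pos (by linarith)
  apply sqAddInvSq_le_of_abs_le
  · rwa [ha']
  · rw [ha']
    nlinarith

lemma sqAddInvSq_le_of_abs_le_inv {a x : ℝ} (ha : 1 ≤ a) (hx : x ≠ 0) (h : |x| ≤ a⁻¹) :
    sqAddInvSq a ≤ sqAddInvSq x := by
  rw [← sqAddInvSq_inv x]
  apply sqAddInvSq_le_of_le_abs ha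
  rw [abs_inv]
  exact (le_inv_comm₀ (abs_pos.mpr hx) (by linarith)).mp h

lemma sqAddInvSq_le_of_inv_le_abs {a x : ℝ} (ha : 1 ≤ a) (h : a⁻¹ ≤ |x|) (h' : |x| ≤ a) :
    sqAddInvSq x ≤ sqAddInvSq a := by
  have ha0 : 0 < a := by linarith
  apply sqAddInvSq_le_of_abs_le
  · rwa [abs_of_pos ha0]
  · rwa [abs_of_pos ha0, ← inv_le_iff_one_le_mul₀ ha0]

lemma two_le_sqAddInvSq {x : ℝ} (hx : x ≠ 0) : 2 ≤ sqAddInvSq x := by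
  have : x * x⁻¹ = 1 := mul_inv_cancel₀ hx
  unfold sqAddInvSq
  nlinarith [sq_nonneg (x - x⁻¹)]

lemma exists_sqAddInvSq_eq {r : ℝ} (hr : 2 ≤ r) : ∃ x : ℝ, x ≠ 0 ∧ sqAddInvSq x = r := by
  have hD : √(r ^ 2 - 4) ^ 2 = r ^ 2 - 4 := Real.sq_sqrt (by nlinarith)
  have hu : 0 < (r + √(r ^ 2 - 4)) / 2 := by positivity
  refine ⟨√((r + √(r ^ 2 - 4)) / 2), (Real.sqrt_pos.mpr hu).ne', ?_⟩
  rw [sqAddInvSq, inv_pow, Real.sq_sqrt hu.le]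
  field_simp
  linarith

/-- A monic real quadratic without roots in `[c, ∞)` is positive there. -/
lemma quadratic_pos_of_ne_zero {p q c : ℝ} (h : ∀ r, c ≤ r → r ^ 2 + p * r + q ≠ 0)
    {s : ℝ} (hs : c ≤ s) : 0 < s ^ 2 + p * s + q := by
  by_contra! hneg
  have hdisc : (2 * s + p) ^ 2 ≤ p ^ 2 - 4 * q := by nlinarith
  have hD : √(p ^ 2 - 4 * q) ^ 2 = p ^ 2 - 4 * q :=
    Real.sq_sqrt ((sq_nonneg _).trans hdisc)
  have hle : 2 * s + p ≤ √(p ^ 2 - 4 * q) := Real.le_sqrt_of_sq_le hdisc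
  refine h ((-p + √(p ^ 2 - 4 * q)) / 2) (by linarith) ?_
  nlinarith

lemma Pfac_I_mul {lam₁ lam₂ : ℂ} (h₁ : lam₁ ≠ 0) (h₂ : lam₂ ≠ 0) {β : ℝ} (hβ : β ≠ 0) :
    Pfac lam₁ lam₂ (I * β) =
      (sqAddInvSq β + (lam₁ ^ 2 + lam₁⁻¹ ^ 2)) * (sqAddInvSq β + (lam₂ ^ 2 + lam₂⁻¹ ^ 2)) / 4 := by
  have hβ' : (β : ℂ) ≠ 0 := by exact_mod_cast hβ
  have hI4 : I ^ 4 = 1 := I_pow_four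
  simp only [Pfac, sqAddInvSq, mul_pow, I_sq, hI4]
  push_cast
  field_simp
  ring

lemma I_mul_sq_add_inv_sq (β : ℝ) :
    (I * β) ^ 2 + (I * β : ℂ)⁻¹ ^ 2 = ((-sqAddInvSq β : ℝ) : ℂ) := by
  simp only [sqAddInvSq, mul_inv, mul_pow, inv_pow, I_sq]
  push_cast
  ring

lemma exp_I_mul_sq_add_inv_sq (α : ℝ) :
    exp (I * α) ^ 2 + (exp (I * α))⁻¹ ^ 2 = ((2 * Real.cos (2 * α) : ℝ) : ℂ) := by
  rw [← exp_neg, ← exp_nat_mul, ← exp_nat_mul]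
  push_cast
  rw [two_cos]
  congr 2 <;> ring

lemma re_eq_zero_of_sq_eq_neg {z Λ : ℂ} (him : z.im = 0) (hre : 0 ≤ z.re) (h : Λ ^ 2 = -z) :
    Λ.re = 0 := by
  have h_re := congrArg Complex.re h
  have h_im := congrArg Complex.im h
  simp only [sq, mul_re, mul_im, neg_re, neg_im, him] at h_re h_im
  have hmul : Λ.re * Λ.im = 0 := by linarith
  rcases mul_eq_zero.mp hmul with h0 | h0
  · exact h0
  · rw [h0] at h_re
    exact mul_self_eq_zero.mp (le_antisymm (by linarith) (mul_self_nonneg _))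

/-- A value that is real and nonnegative satisfies all conclusions drawn about `P(iβ)`. -/
lemma real_nonneg_conclusion {z : ℂ} {r : ℝ} (hz : z = r) (hr : 0 ≤ r) :
    z.im = 0 ∧ 0 ≤ z.re ∧ ∀ Λ : ℂ, Λ ^ 2 = -z → Λ.re = 0 := by
  have him : z.im = 0 := by rw [hz, ofReal_im]
  have hre : 0 ≤ z.re := by rwa [hz, ofReal_re]
  exact ⟨him, hre, fun Λ => re_eq_zero_of_sq_eq_neg him hre⟩

/-- behaviour of `P(iβ)` for `β ∈ ℝ \ {0}` in the three cases
(i) real parameters `(ω, b)` and no purely imaginary roots;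
(ii) `λ₁ ∈ S¹`, `λ₂ = iβ₂`, `β₂ ≥ 1`; (iii) `λ₁ = iβ₁`, `λ₂ = iβ₂`, `β₁ ≥ β₂ ≥ 1`;
in each case `Λ = ±i√(P(iβ))` is purely imaginary for the stated `β`. -/
theorem mtm_imaginary_lax_spectrum (lam₁ lam₂ : ℂ) (h₁ : lam₁ ≠ 0) (h₂ : lam₂ ≠ 0) :
    -- (i)
    (((lam₁ ^ 2 + lam₁⁻¹ ^ 2 + lam₂ ^ 2 + lam₂⁻¹ ^ 2) / 4).im = 0 →
      ((((lam₁ ^ 2 + lam₁⁻¹ ^ 2 + lam₂ ^ 2 + lam₂⁻¹ ^ 2) / 4) ^ 2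
        - (lam₁ ^ 2 + lam₁⁻¹ ^ 2) * (lam₂ ^ 2 + lam₂⁻¹ ^ 2) / 4).im = 0) →
      (∀ β : ℝ, β ≠ 0 → Pfac lam₁ lam₂ (Complex.I * (β : ℂ)) ≠ 0) →
      ∀ β : ℝ, β ≠ 0 →
        (Pfac lam₁ lam₂ (Complex.I * (β : ℂ))).im = 0 ∧
        0 < (Pfac lam₁ lam₂ (Complex.I * (β : ℂ))).re ∧
        (∀ Λ : ℂ, Λ ^ 2 = -Pfac lam₁ lam₂ (Complex.I * (β : ℂ)) → Λ.re = 0)) ∧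
    -- (ii)
    (∀ α₁ β₂ : ℝ, lam₁ = Complex.exp (Complex.I * (α₁ : ℂ)) →
      lam₂ = Complex.I * (β₂ : ℂ) → 1 ≤ β₂ →
      ∀ β : ℝ, β ≠ 0 →
        (β ≤ -β₂ ∨ (-β₂⁻¹ ≤ β ∧ β ≤ β₂⁻¹) ∨ β₂ ≤ β) →
        (Pfac lam₁ lam₂ (Complex.I * (β : ℂ))).im = 0 ∧
        0 ≤ (Pfac lam₁ lam₂ (Complex.I * (β : ℂ))).re ∧
        (∀ Λ : ℂ, Λ ^ 2 = -Pfac lam₁ lam₂ (Complex.I * (β : ℂ)) → Λ.re = 0)) ∧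
    -- (iii)
    (∀ β₁ β₂ : ℝ, lam₁ = Complex.I * (β₁ : ℂ) → lam₂ = Complex.I * (β₂ : ℂ) →
      1 ≤ β₂ → β₂ ≤ β₁ →
      ∀ β : ℝ, β ≠ 0 →
        (β ≤ -β₁ ∨ (-β₂ ≤ β ∧ β ≤ -β₂⁻¹) ∨ (-β₁⁻¹ ≤ β ∧ β ≤ β₁⁻¹) ∨
          (β₂⁻¹ ≤ β ∧ β ≤ β₂) ∨ β₁ ≤ β) →
        (Pfac lam₁ lam₂ (Complex.I * (β : ℂ))).im = 0 ∧
        0 ≤ (Pfac lam₁ lam₂ (Complex.I * (β : ℂ))).re ∧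
        (∀ Λ : ℂ, Λ ^ 2 = -Pfac lam₁ lam₂ (Complex.I * (β : ℂ)) → Λ.re = 0)) := by
  refine ⟨fun hω hb hne β hβ => ?_, ?_, ?_⟩
  · set ω := (lam₁ ^ 2 + lam₁⁻¹ ^ 2 + lam₂ ^ 2 + lam₂⁻¹ ^ 2) / 4 with hω_def
    set b := ω ^ 2 - (lam₁ ^ 2 + lam₁⁻¹ ^ 2) * (lam₂ ^ 2 + lam₂⁻¹ ^ 2) / 4 with hb_def
    have hωre : ω = (ω.re : ℂ) := Complex.ext rfl (by simpa using hω)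
    have hbre : b = (b.re : ℂ) := Complex.ext rfl (by simpa using hb)
    have hP : ∀ β : ℝ, β ≠ 0 → Pfac lam₁ lam₂ (I * β) =
        (((sqAddInvSq β ^ 2 + 4 * ω.re * sqAddInvSq β + 4 * (ω.re ^ 2 - b.re)) / 4 : ℝ) : ℂ) := by
      intro β hβ
      push_cast
      rw [← hωre, ← hbre, Pfac_I_mul h₁ h₂ hβ, hb_def, hω_def]
      ring
    have hpos := quadratic_pos_of_ne_zero (p := 4 * ω.re) (q := 4 * (ω.re ^ 2 - b.re)) (c := 2)
      (fun r hr h0 => by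
        obtain ⟨x, hx, rfl⟩ := exists_sqAddInvSq_eq hr
        exact hne x hx (by rw [hP x hx, h0]; simp)) (two_le_sqAddInvSq hβ)
    obtain ⟨him, -, hΛ⟩ := real_nonneg_conclusion (hP β hβ) (by positivity)
    refine ⟨him, ?_, hΛ⟩
    rw [hP β hβ, ofReal_re]
    positivity
  · rintro α₁ β₂ rfl rfl hβ₂ β hβ hcase
    have hP : Pfac (exp (I * α₁)) (I * β₂) (I * β) =
        (((sqAddInvSq β + 2 * Real.cos (2 * α₁)) * (sqAddInvSq β - sqAddInvSq β₂) / 4 : ℝ) : ℂ) := by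
      rw [Pfac_I_mul h₁ h₂ hβ, exp_I_mul_sq_add_inv_sq, I_mul_sq_add_inv_sq]
      push_cast
      ring
    have hle : sqAddInvSq β₂ ≤ sqAddInvSq β := by
      rcases hcase with h | ⟨h, h'⟩ | h
      · exact sqAddInvSq_le_of_le_abs hβ₂ (le_abs.mpr (Or.inr (by linarith)))
      · exact sqAddInvSq_le_of_abs_le_inv hβ₂ hβ (abs_le.mpr ⟨h, h'⟩)
      · exact sqAddInvSq_le_of_le_abs hβ₂ (le_abs.mpr (Or.inl h))
    have hcos : 0 ≤ sqAddInvSq β + 2 * Real.cos (2 * α₁) := by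
      linarith [two_le_sqAddInvSq hβ, Real.neg_one_le_cos (2 * α₁)]
    exact real_nonneg_conclusion hP
      (div_nonneg (mul_nonneg hcos (sub_nonneg.mpr hle)) (by norm_num))
  · rintro β₁ β₂ rfl rfl hβ₂ hβ₁₂ β hβ hcase
    have hβ₁ : 1 ≤ β₁ := hβ₂.trans hβ₁₂
    have hP : Pfac (I * β₁) (I * β₂) (I * β) =
        (((sqAddInvSq β - sqAddInvSq β₁) * (sqAddInvSq β - sqAddInvSq β₂) / 4 : ℝ) : ℂ) := by
      rw [Pfac_I_mul h₁ h₂ hβ, I_mul_sq_add_inv_sq, I_mul_sq_add_inv_sq]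
      push_cast
      ring
    have hle : sqAddInvSq β₂ ≤ sqAddInvSq β₁ :=
      sqAddInvSq_le_of_le_abs hβ₂ (hβ₁₂.trans (le_abs_self _))
    have hout : sqAddInvSq β₁ ≤ sqAddInvSq β ∨ sqAddInvSq β ≤ sqAddInvSq β₂ := by
      have hβ₂inv : 0 < β₂⁻¹ := by positivity
      rcases hcase with h | ⟨h, h'⟩ | ⟨h, h'⟩ | ⟨h, h'⟩ | h
      · exact Or.inl (sqAddInvSq_le_of_le_abs hβ₁ (le_abs.mpr (Or.inr (by linarith))))
      · exact Or.inr (sqAddInvSq_le_of_inv_le_abs hβ₂ (le_abs.mpr (Or.inr (by linarith)))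
          (abs_le.mpr ⟨h, by linarith⟩))
      · exact Or.inl (sqAddInvSq_le_of_abs_le_inv hβ₁ hβ (abs_le.mpr ⟨h, h'⟩))
      · exact Or.inr (sqAddInvSq_le_of_inv_le_abs hβ₂ (le_abs.mpr (Or.inl h))
          (abs_le.mpr ⟨by linarith, h'⟩))
      · exact Or.inl (sqAddInvSq_le_of_le_abs hβ₁ (le_abs.mpr (Or.inl h)))
    refine real_nonneg_conclusion hP (div_nonneg ?_ (by norm_num))
    rcases hout with h | h
    · exact mul_nonneg (by linarith) (by linarith)
    · exact mul_nonneg_of_nonpos_of_nonpos (by linarith) (by linarith)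
end

section
/- Let α₁ > 1 and set λ₁ = α₁e^{iπ/4}, λ₂ = α₁e^{−iπ/4}. Define P(λ) = (1/(4λ⁴))(λ² − λ₁²)(λ² − λ₁⁻²)(λ² − λ₂²)(λ² − λ₂⁻²) for λ ∈ ℂ \ {0}. Then for every α > 0 and every choice of signs, P(±αe^{±iπ/4}) = −(1/(4α⁴))(α⁴ − α₁⁴)(α⁴ − α₁⁻⁴); in particular, P(±αe^{±iπ/4}) is real and nonnegative for all α with α₁⁻¹ ≤ α ≤ α₁, so Λ = ±i√(P(λ)) is purely imaginary for λ = ±αe^{±iπ/4} with α₁⁻¹ ≤ α ≤ α₁. -/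
open Complex

theorem exp_I_mul_pi_div_four_sq :
    Complex.exp (Complex.I * (Real.pi / 4 : ℝ)) ^ 2 = Complex.I := by
  rw [← Complex.exp_nat_mul]
  refine Eq.trans (congrArg Complex.exp ?_) Complex.exp_pi_div_two_mul_I
  push_cast
  ring

theorem exp_neg_I_mul_pi_div_four_sq :
    Complex.exp (-(Complex.I * (Real.pi / 4 : ℝ))) ^ 2 = -Complex.I := by
  rw [Complex.exp_neg, inv_pow, exp_I_mul_pi_div_four_sq, Complex.inv_I]

/-- `Pfac` when `λ₁² = ia²`, `λ₂² = -ia²` and `λ⁴ = -b⁴`. -/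
theorem Pfac_of_diagonal {a b lam₁ lam₂ lam : ℂ}
    (h₁ : lam₁ ^ 2 = Complex.I * a ^ 2) (h₂ : lam₂ ^ 2 = -Complex.I * a ^ 2)
    (h : lam ^ 4 = -b ^ 4) :
    Pfac lam₁ lam₂ lam = -(1 / (4 * b ^ 4)) * (b ^ 4 - a ^ 4) * (b ^ 4 - a⁻¹ ^ 4) := by
  have outer : (lam ^ 2 - Complex.I * a ^ 2) * (lam ^ 2 - -Complex.I * a ^ 2)
      = -(b ^ 4 - a ^ 4) := by
    linear_combination h - a ^ 4 * Complex.I_sq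
  have inner : (lam ^ 2 - -Complex.I * a⁻¹ ^ 2) * (lam ^ 2 - Complex.I * a⁻¹ ^ 2)
      = -(b ^ 4 - a⁻¹ ^ 4) := by
    linear_combination h - a⁻¹ ^ 4 * Complex.I_sq
  have inv₁ : lam₁⁻¹ ^ 2 = -Complex.I * a⁻¹ ^ 2 := by
    rw [inv_pow, h₁, mul_inv, Complex.inv_I, inv_pow]
  have inv₂ : lam₂⁻¹ ^ 2 = Complex.I * a⁻¹ ^ 2 := by
    rw [inv_pow, h₂, mul_inv, inv_neg, Complex.inv_I, neg_neg, inv_pow]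
  have prefactor : 1 / (4 * lam ^ 4) = -(1 / (4 * b ^ 4)) := by
    rw [h, mul_neg, div_neg]
  rw [Pfac, prefactor, inv₁, inv₂, h₁, h₂]
  linear_combination -(1 / (4 * b ^ 4)) *
    ((lam ^ 2 - -Complex.I * a⁻¹ ^ 2) * (lam ^ 2 - Complex.I * a⁻¹ ^ 2) * outer
      - (b ^ 4 - a ^ 4) * inner)

theorem re_eq_zero_of_sq_eq_neg_ofReal {r : ℝ} (hr : 0 ≤ r) {z : ℂ} (hz : z ^ 2 = -(r : ℂ)) :
    z.re = 0 := by
  have hre := congrArg Complex.re hz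
  have him := congrArg Complex.im hz
  simp only [sq, Complex.mul_re, Complex.mul_im, Complex.neg_re, Complex.neg_im,
    Complex.ofReal_re, Complex.ofReal_im] at hre him
  by_contra hne
  have hzero : z.im = 0 := by
    have : z.re * z.im = 0 := by linarith
    exact (mul_eq_zero.mp this).resolve_left hne
  rw [hzero] at hre
  have : 0 < z.re * z.re := mul_self_pos.mpr hne
  linarith

/-- for `λ₁ = α₁e^{iπ/4}`, `λ₂ = α₁e^{−iπ/4}` with `α₁ > 1`, along
the diagonals `λ = ±αe^{±iπ/4}` one has
`P(λ) = −(1/(4α⁴))(α⁴ − α₁⁴)(α⁴ − α₁⁻⁴)`, which is real and nonnegative for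
`α₁⁻¹ ≤ α ≤ α₁`, so `Λ = ±i√(P(λ))` is purely imaginary there. -/
theorem mtm_diagonal_spectrum (α₁ : ℝ) (hα₁ : 1 < α₁) (lam₁ lam₂ : ℂ)
    (hl₁ : lam₁ = (α₁ : ℂ) * Complex.exp (Complex.I * (Real.pi / 4 : ℝ)))
    (hl₂ : lam₂ = (α₁ : ℂ) * Complex.exp (-(Complex.I * (Real.pi / 4 : ℝ)))) :
    ∀ α : ℝ, 0 < α → ∀ lam : ℂ,
      (lam = (α : ℂ) * Complex.exp (Complex.I * (Real.pi / 4 : ℝ)) ∨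
       lam = (α : ℂ) * Complex.exp (-(Complex.I * (Real.pi / 4 : ℝ))) ∨
       lam = -((α : ℂ) * Complex.exp (Complex.I * (Real.pi / 4 : ℝ))) ∨
       lam = -((α : ℂ) * Complex.exp (-(Complex.I * (Real.pi / 4 : ℝ))))) →
      Pfac lam₁ lam₂ lam
        = -(1 / (4 * (α : ℂ) ^ 4)) * ((α : ℂ) ^ 4 - (α₁ : ℂ) ^ 4)
            * ((α : ℂ) ^ 4 - ((α₁ : ℂ)⁻¹) ^ 4) ∧
      (α₁⁻¹ ≤ α → α ≤ α₁ →
        (Pfac lam₁ lam₂ lam).im = 0 ∧ 0 ≤ (Pfac lam₁ lam₂ lam).re ∧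
        (∀ Λ : ℂ, Λ ^ 2 = -Pfac lam₁ lam₂ lam → Λ.re = 0)) := by
  intro α hα lam hlam
  have h₁ : lam₁ ^ 2 = Complex.I * (α₁ : ℂ) ^ 2 := by
    rw [hl₁, mul_pow, exp_I_mul_pi_div_four_sq, mul_comm]
  have h₂ : lam₂ ^ 2 = -Complex.I * (α₁ : ℂ) ^ 2 := by
    rw [hl₂, mul_pow, exp_neg_I_mul_pi_div_four_sq, mul_comm]
  have hsq : lam ^ 2 = (α : ℂ) ^ 2 * Complex.I ∨ lam ^ 2 = (α : ℂ) ^ 2 * -Complex.I := by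
    rcases hlam with rfl | rfl | rfl | rfl <;>
      simp only [neg_sq, mul_pow, exp_I_mul_pi_div_four_sq, exp_neg_I_mul_pi_div_four_sq,
        true_or, or_true]
  have h : lam ^ 4 = -(α : ℂ) ^ 4 := by
    have hpow : lam ^ 4 = (lam ^ 2) ^ 2 := by ring
    rcases hsq with hsq | hsq <;> rw [hpow, hsq] <;>
      linear_combination (α : ℂ) ^ 4 * Complex.I_sq
  have hP := Pfac_of_diagonal h₁ h₂ h
  refine ⟨hP, fun hlo hhi => ?_⟩
  have hα₁pos : 0 < α₁ := by linarith
  set r : ℝ := -(1 / (4 * α ^ 4)) * (α ^ 4 - α₁ ^ 4) * (α ^ 4 - α₁⁻¹ ^ 4) with hr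
  have hPr : Pfac lam₁ lam₂ lam = (r : ℂ) := by
    rw [hP, hr]
    push_cast
    rfl
  have hr0 : 0 ≤ r := by
    have hupper : 0 ≤ α₁ ^ 4 - α ^ 4 := sub_nonneg.mpr (by gcongr)
    have hlower : 0 ≤ α ^ 4 - α₁⁻¹ ^ 4 := sub_nonneg.mpr (by gcongr)
    have hrw : r = 1 / (4 * α ^ 4) * (α₁ ^ 4 - α ^ 4) * (α ^ 4 - α₁⁻¹ ^ 4) := by
      rw [hr]
      ring
    rw [hrw]
    positivity
  rw [hPr]
  exact ⟨Complex.ofReal_im r, by rwa [Complex.ofReal_re],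
    fun Λ hΛ => re_eq_zero_of_sq_eq_neg_ofReal hr0 hΛ⟩
end

section
/- Let ω < −1 and define Q(λ) = (1/16)(λ² − λ⁻²)² − (1/4)(λ − λ⁻¹)²(1 + ω) for λ ∈ ℂ \ {0}. (This is the value of κ² for which e^{iκx}(p̂, q̂) is a nonzero solution of the Lax spectral system with constant potentials U = V = √(−(1+ω)).) Then Q(λ) is a nonnegative real number if and only if λ ∈ ℝ \ {0}, or λ = iβ with β ∈ ((−∞, −β₂] ∪ [−β₂⁻¹, β₂⁻¹] ∪ [β₂, ∞)) \ {0}, where β₂ = √(−(1+ω)) + √(−ω). -/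
open Complex

/-- For `0 < a`, the polynomial `(z - 2) (z + 2 + 4 a)` takes nonnegative real values only
at real `z = x + i y`. -/
lemma im_eq_zero_of_sub_mul_add_nonneg {a x y : ℝ} (ha : 0 < a)
    (him : y * (x + 2 * a) = 0) (hre : 0 ≤ (x - 2) * (x + 2 + 4 * a) - y ^ 2) : y = 0 := by
  rcases mul_eq_zero.1 him with h | h
  · exact h
  · have hx : x = -2 * a := by linarith
    subst hx
    nlinarith [sq_nonneg y, sq_nonneg (a + 1)]

lemma sq_sub_mul_sq_sub_inv_nonneg_iff {b β : ℝ} (hb : 1 < b) :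
    0 ≤ (β ^ 2 - b ^ 2) * (β ^ 2 - b⁻¹ ^ 2) ↔
      β ≤ -b ∨ (-b⁻¹ ≤ β ∧ β ≤ b⁻¹) ∨ b ≤ β := by
  have hb0 : 0 < b := by linarith
  have hc : 0 < b⁻¹ := inv_pos.2 hb0
  have hcb : b⁻¹ < b := (inv_lt_one_of_one_lt₀ hb).trans hb
  rw [← abs_le, ← sq_abs β]
  have h1 : b ≤ |β| ↔ β ≤ -b ∨ b ≤ β := le_abs'
  have h2 : (β ≤ -b ∨ |β| ≤ b⁻¹ ∨ b ≤ β) ↔ (b ≤ |β| ∨ |β| ≤ b⁻¹) := by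
    rw [h1]; tauto
  rw [h2]
  generalize hx : |β| = x
  have hx0 : 0 ≤ x := hx ▸ abs_nonneg β
  generalize b⁻¹ = c at *
  constructor
  · intro h
    by_contra! hn
    have e1 : x ^ 2 < b ^ 2 := by nlinarith
    have e2 : c ^ 2 < x ^ 2 := by nlinarith
    nlinarith [mul_pos (sub_pos.2 e1) (sub_pos.2 e2)]
  · rintro (h | h)
    · exact mul_nonneg (by nlinarith) (by nlinarith)
    · exact mul_nonneg_of_nonpos_of_nonpos (by nlinarith) (by nlinarith)

/-- the Lax spectrum of the constant-amplitude solution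
`U = V = √(−(1+ω))` (the equilibrium P₊), characterized as the set of `λ ≠ 0`
for which `Q(λ) = (1/16)(λ² − λ⁻²)² − (1/4)(λ − λ⁻¹)²(1 + ω)` is a nonnegative
real number. -/
theorem mtm_lax_spectrum_Pplus (ω : ℝ) (hω : ω < -1) (Q : ℂ → ℂ)
    (hQ : ∀ lam : ℂ, Q lam = 1 / 16 * (lam ^ 2 - lam⁻¹ ^ 2) ^ 2
      - 1 / 4 * (lam - lam⁻¹) ^ 2 * (1 + (ω : ℂ))) :
    ∀ lam : ℂ, lam ≠ 0 →
      (((Q lam).im = 0 ∧ 0 ≤ (Q lam).re) ↔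
        (lam.im = 0 ∨
          ∃ β : ℝ, lam = Complex.I * (β : ℂ) ∧
            (β ≤ -(Real.sqrt (-(1 + ω)) + Real.sqrt (-ω)) ∨
             (-(Real.sqrt (-(1 + ω)) + Real.sqrt (-ω))⁻¹ ≤ β ∧
               β ≤ (Real.sqrt (-(1 + ω)) + Real.sqrt (-ω))⁻¹) ∨
             Real.sqrt (-(1 + ω)) + Real.sqrt (-ω) ≤ β))) := by
  intro lam hlam
  obtain ⟨u, v⟩ := lam
  have hn : u ^ 2 + v ^ 2 ≠ 0 := by
    intro h
    apply hlam
    have hu : u = 0 := by nlinarith [sq_nonneg u, sq_nonneg v]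
    have hv : v = 0 := by nlinarith [sq_nonneg u, sq_nonneg v]
    simp [hu, hv, Complex.ext_iff]
  obtain ⟨m, hm⟩ : ∃ m : ℝ, m = (u ^ 2 + v ^ 2)⁻¹ := ⟨_, rfl⟩
  have hmn : m * (u ^ 2 + v ^ 2) = 1 := by rw [hm]; exact inv_mul_cancel₀ hn
  have hm0 : 0 < m := by
    rw [hm]; positivity
  have hinv : (⟨u, v⟩ : ℂ)⁻¹ = ⟨u * m, -v * m⟩ := by
    apply Complex.ext <;> simp [Complex.inv_re, Complex.inv_im, Complex.normSq_apply, hm,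
      div_eq_mul_inv, sq]
  obtain ⟨x, hx⟩ : ∃ x : ℝ, x = (u ^ 2 - v ^ 2) * (1 + m ^ 2) := ⟨_, rfl⟩
  obtain ⟨y, hy⟩ : ∃ y : ℝ, y = 2 * u * v * (1 - m ^ 2) := ⟨_, rfl⟩
  have hz : (⟨u, v⟩ : ℂ) ^ 2 + (⟨u, v⟩ : ℂ)⁻¹ ^ 2 = ⟨x, y⟩ := by
    rw [hinv]
    apply Complex.ext <;> simp [sq, hx, hy] <;> ring
  have hQz : Q ⟨u, v⟩ = ((1 / 16 : ℝ) : ℂ) *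
      (((⟨x, y⟩ : ℂ) - (2 : ℝ)) * ((⟨x, y⟩ : ℂ) + ((2 + 4 * -(1 + ω) : ℝ) : ℂ))) := by
    rw [hQ, ← hz]
    push_cast
    field_simp
    ring
  obtain ⟨a, ha⟩ : ∃ a : ℝ, a = -(1 + ω) := ⟨_, rfl⟩
  have ha0 : 0 < a := by linarith
  rw [← ha] at hQz ⊢
  rw [show -ω = a + 1 by linarith]
  have him : (Q ⟨u, v⟩).im = 1 / 8 * (y * (x + 2 * a)) := by
    rw [hQz, Complex.im_ofReal_mul]
    simp only [Complex.mul_im, Complex.sub_re, Complex.sub_im, Complex.add_re, Complex.add_im,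
      Complex.ofReal_re, Complex.ofReal_im]
    ring
  have hre : (Q ⟨u, v⟩).re = 1 / 16 * ((x - 2) * (x + 2 + 4 * a) - y ^ 2) := by
    rw [hQz, Complex.re_ofReal_mul]
    simp only [Complex.mul_re, Complex.sub_re, Complex.sub_im, Complex.add_re, Complex.add_im,
      Complex.ofReal_re, Complex.ofReal_im]
    ring
  obtain ⟨b, hb⟩ : ∃ b : ℝ, b = √a + √(a + 1) := ⟨_, rfl⟩
  have hs : √a ^ 2 = a := Real.sq_sqrt ha0.le
  have ht : √(a + 1) ^ 2 = a + 1 := Real.sq_sqrt (by linarith)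
  have hs0 : 0 < √a := Real.sqrt_pos.2 ha0
  have hb1 : 1 < b := by
    have : 1 ≤ √(a + 1) := Real.one_le_sqrt.2 (by linarith)
    linarith
  have hbinv : b⁻¹ = √(a + 1) - √a := by
    apply inv_eq_of_mul_eq_one_right
    rw [hb]
    linear_combination ht - hs
  have hbsum : b ^ 2 + b⁻¹ ^ 2 = 4 * a + 2 := by
    rw [hbinv, hb]
    linear_combination 2 * ht + 2 * hs
  have hbprod : b ^ 2 * b⁻¹ ^ 2 = 1 := by
    rw [← mul_pow, mul_inv_cancel₀ (by linarith), one_pow]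
  rw [← hb, him, hre]
  have himag : u = 0 → (0 ≤ (x - 2) * (x + 2 + 4 * a) ↔
      v ≤ -b ∨ (-b⁻¹ ≤ v ∧ v ≤ b⁻¹) ∨ b ≤ v) := by
    rintro rfl
    have hmv : m * v ^ 2 = 1 := by linarith
    have hx' : x = -(v ^ 2 + m) := by
      rw [hx]; linear_combination -m * hmv
    have hx2 : x - 2 < 0 := by
      rw [hx']; nlinarith [sq_nonneg v]
    rw [← sq_sub_mul_sq_sub_inv_nonneg_iff hb1]
    have key : (v ^ 2 - b ^ 2) * (v ^ 2 - b⁻¹ ^ 2) = v ^ 2 * -(x + 2 + 4 * a) := by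
      rw [hx']
      linear_combination (-v ^ 2) * hbsum + hbprod - hmv
    have hv2 : 0 < v ^ 2 := by nlinarith [sq_nonneg v]
    rw [key, mul_nonneg_iff_of_pos_left hv2, ← neg_mul_neg (x - 2),
      mul_nonneg_iff_of_pos_left (neg_pos.2 hx2)]
  constructor
  · rintro ⟨h1, h2⟩
    have hy0 : y = 0 := im_eq_zero_of_sub_mul_add_nonneg (x := x) ha0 (by linarith) (by linarith)
    have hxx : 0 ≤ (x - 2) * (x + 2 + 4 * a) := by
      rw [hy0] at h2; linarith
    have hcases : u = 0 ∨ v = 0 ∨ m = 1 := by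
      have h : u * (v * ((1 - m) * (1 + m))) = 0 := by linear_combination (hy0 - hy) / 2
      rcases mul_eq_zero.1 h with h | h
      · exact .inl h
      rcases mul_eq_zero.1 h with h | h
      · exact .inr (.inl h)
      rcases mul_eq_zero.1 h with h | h
      · exact .inr (.inr (by linarith))
      · linarith
    rcases hcases with h | h | h
    · refine .inr ⟨v, ?_, (himag h).1 hxx⟩
      apply Complex.ext <;> simp [h]
    · exact .inl h
    · left
      subst h
      have e1 : x - 2 = -4 * v ^ 2 := by rw [hx]; linear_combination 2 * hmn
      have e2 : x + 2 + 4 * a = 4 * u ^ 2 + 4 * a := by rw [hx]; linear_combination -2 * hmn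
      rw [e1, e2] at hxx
      by_contra hv
      have hv' : v ≠ 0 := hv
      have : 0 < v ^ 2 * (4 * u ^ 2 + 4 * a) := by positivity
      linarith
  · rintro (h | ⟨β, hβ, h⟩)
    · have hv : v = 0 := h
      subst hv
      have hy0 : y = 0 := by rw [hy]; ring
      have hmu : m * u ^ 2 = 1 := by linarith
      have hx' : x - 2 = m * (u ^ 2 - 1) ^ 2 := by
        rw [hx]; linear_combination (m - u ^ 2 + 2) * hmu
      have hx2 : 0 ≤ x - 2 := by rw [hx']; positivity
      refine ⟨by rw [hy0]; ring, ?_⟩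
      have : 0 ≤ (x - 2) * (x + 2 + 4 * a) := mul_nonneg hx2 (by linarith)
      rw [hy0]; linarith
    · have hu : u = 0 := by simpa using congrArg Complex.re hβ
      have hv : v = β := by simpa using congrArg Complex.im hβ
      have hy0 : y = 0 := by rw [hy, hu]; ring
      rw [← hv] at h
      have := (himag hu).2 h
      refine ⟨by rw [hy0]; ring, ?_⟩
      rw [hy0]; linarith
end

section
/- Let ω < −1, b = (1+ω)², and P(λ) = (1/4)(λ² + λ⁻² − 2ω)² − b for λ ∈ ℂ \ {0}. Then P(λ) = (1/(4λ⁴))(λ² + 1)²(λ² + β₂²)(λ² + β₂⁻²) where β₂ = √(−(1+ω)) + √(−ω); in particular the roots of P, counted with multiplicity, are ±i (each double), ±iβ₂, and ±iβ₂⁻¹. -/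
open Complex

lemma sq_add_sq_eq_zero_iff (z w : ℂ) : z ^ 2 + w ^ 2 = 0 ↔ z = I * w ∨ z = -(I * w) := by
  rw [← sq_eq_sq_iff_eq_or_eq_neg, mul_pow, I_sq, neg_one_mul, add_eq_zero_iff_eq_neg]

lemma mtm_characteristic_factorization {ω β γ lam : ℂ} (hmul : β * γ = 1)
    (hadd : β ^ 2 + γ ^ 2 = -2 * (1 + 2 * ω)) (hlam : lam ≠ 0) :
    1 / 4 * (lam ^ 2 + lam⁻¹ ^ 2 - 2 * ω) ^ 2 - (1 + ω) ^ 2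
      = 1 / (4 * lam ^ 4) * (lam ^ 2 + 1) ^ 2 * (lam ^ 2 + β ^ 2) * (lam ^ 2 + γ ^ 2) := by
  have hquad : (lam ^ 2 + β ^ 2) * (lam ^ 2 + γ ^ 2)
      = lam ^ 4 - 2 * (1 + 2 * ω) * lam ^ 2 + 1 := by
    linear_combination lam ^ 2 * hadd + (β * γ + 1) * hmul
  rw [mul_assoc, hquad]
  field_simp
  ring

/-- factorization of the characteristic function
`P(λ) = (1/4)(λ² + λ⁻² − 2ω)² − (1+ω)²` at the constant-amplitude solution P₊:
the roots are ±i (double), ±iβ₂, ±iβ₂⁻¹ with β₂ = √(−(1+ω)) + √(−ω). -/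
theorem mtm_characteristic_roots_Pplus (ω : ℝ) (hω : ω < -1) :
    ∀ lam : ℂ, lam ≠ 0 →
      1 / 4 * (lam ^ 2 + lam⁻¹ ^ 2 - 2 * (ω : ℂ)) ^ 2 - (((1 + ω) ^ 2 : ℝ) : ℂ)
        = 1 / (4 * lam ^ 4) * (lam ^ 2 + 1) ^ 2
          * (lam ^ 2 + ((Real.sqrt (-(1 + ω)) + Real.sqrt (-ω) : ℝ) : ℂ) ^ 2)
          * (lam ^ 2 + (((Real.sqrt (-(1 + ω)) + Real.sqrt (-ω) : ℝ)⁻¹ : ℝ) : ℂ) ^ 2) ∧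
      (1 / 4 * (lam ^ 2 + lam⁻¹ ^ 2 - 2 * (ω : ℂ)) ^ 2 - (((1 + ω) ^ 2 : ℝ) : ℂ) = 0 ↔
        lam = Complex.I ∨ lam = -Complex.I ∨
        lam = Complex.I * ((Real.sqrt (-(1 + ω)) + Real.sqrt (-ω) : ℝ) : ℂ) ∨
        lam = -(Complex.I * ((Real.sqrt (-(1 + ω)) + Real.sqrt (-ω) : ℝ) : ℂ)) ∨
        lam = Complex.I * (((Real.sqrt (-(1 + ω)) + Real.sqrt (-ω) : ℝ)⁻¹ : ℝ) : ℂ) ∨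
        lam = -(Complex.I * (((Real.sqrt (-(1 + ω)) + Real.sqrt (-ω) : ℝ)⁻¹ : ℝ) : ℂ))) := by
  intro lam hlam
  have hsq_sub : (√(-ω)) ^ 2 - (√(-(1 + ω))) ^ 2 = 1 := by
    rw [Real.sq_sqrt (by linarith), Real.sq_sqrt (by linarith)]
    ring
  have hsq_add : (√(-ω)) ^ 2 + (√(-(1 + ω))) ^ 2 = -(1 + 2 * ω) := by
    rw [Real.sq_sqrt (by linarith), Real.sq_sqrt (by linarith)]
    ring
  have hinv : (√(-(1 + ω)) + √(-ω))⁻¹ = √(-ω) - √(-(1 + ω)) :=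
    inv_eq_of_mul_eq_one_right (by linear_combination hsq_sub)
  have hmul : (√(-(1 + ω)) + √(-ω)) * (√(-(1 + ω)) + √(-ω))⁻¹ = 1 := by
    rw [hinv]
    linear_combination hsq_sub
  have hadd : (√(-(1 + ω)) + √(-ω)) ^ 2 + (√(-(1 + ω)) + √(-ω))⁻¹ ^ 2 = -2 * (1 + 2 * ω) := by
    rw [hinv]
    linear_combination 2 * hsq_add
  generalize (√(-(1 + ω)) + √(-ω))⁻¹ = γ at hmul hadd ⊢
  generalize √(-(1 + ω)) + √(-ω) = β at hmul hadd ⊢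
  have hfactor := mtm_characteristic_factorization (ω := ω) (β := β) (γ := γ)
    (by exact_mod_cast hmul) (by exact_mod_cast hadd) hlam
  rw [show (((1 + ω) ^ 2 : ℝ) : ℂ) = (1 + (ω : ℂ)) ^ 2 by push_cast; rfl]
  refine ⟨hfactor, ?_⟩
  have hunit : lam ^ 2 + 1 = 0 ↔ lam = I ∨ lam = -I := by
    simpa using sq_add_sq_eq_zero_iff lam 1
  have hne : 1 / (4 * lam ^ 4) ≠ 0 := by simp [hlam]
  rw [hfactor, mul_eq_zero, mul_eq_zero, mul_eq_zero, pow_eq_zero_iff two_ne_zero, hunit,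
    sq_add_sq_eq_zero_iff, sq_add_sq_eq_zero_iff]
  simp only [hne, false_or, or_assoc]
end

section
/- Let λ₁, λ₂ ∈ ℂ \ {0} and define ω, b ∈ ℂ by 4ω = λ₁² + λ₁⁻² + λ₂² + λ₂⁻² and 4ω² − 4b = (λ₁² + λ₁⁻²)(λ₂² + λ₂⁻²). Define u₁ = −(1/4)(λ₁ − λ₁⁻¹ − λ₂ + λ₂⁻¹)², u₂ = −(1/4)(λ₁ + λ₁⁻¹ − λ₂ − λ₂⁻¹)², u₃ = −(1/4)(λ₁ − λ₁⁻¹ + λ₂ − λ₂⁻¹)², u₄ = −(1/4)(λ₁ + λ₁⁻¹ + λ₂ + λ₂⁻¹)². Then for every ξ ∈ ℂ, ξ⁴ + 4ωξ³ + (4ω² + 2b − 4)ξ² + 4bωξ + b² = (ξ − u₁)(ξ − u₂)(ξ − u₃)(ξ − u₄); that is, u₁, u₂, u₃, u₄ are the roots of the quartic polynomial R(ξ) = (b + 2ωξ + ξ²)² − 4ξ², counted with multiplicity. -/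
/-- the roots of the quartic
`R(ξ) = ξ⁴ + 4ωξ³ + (4ω² + 2b − 4)ξ² + 4bωξ + b²` are
`uⱼ = −(1/4)(λ₁ ∓ λ₁⁻¹ ∓ λ₂ ± λ₂⁻¹)²` when `(ω, b)` are given in terms of
`λ₁, λ₂` by `4ω = λ₁² + λ₁⁻² + λ₂² + λ₂⁻²` and
`4ω² − 4b = (λ₁² + λ₁⁻²)(λ₂² + λ₂⁻²)`. -/
theorem mtm_quartic_factorization (lam₁ lam₂ ω b : ℂ)
    (h₁ : lam₁ ≠ 0) (h₂ : lam₂ ≠ 0)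
    (hω : 4 * ω = lam₁ ^ 2 + lam₁⁻¹ ^ 2 + lam₂ ^ 2 + lam₂⁻¹ ^ 2)
    (hb : 4 * ω ^ 2 - 4 * b = (lam₁ ^ 2 + lam₁⁻¹ ^ 2) * (lam₂ ^ 2 + lam₂⁻¹ ^ 2)) :
    ∀ ξ : ℂ,
      ξ ^ 4 + 4 * ω * ξ ^ 3 + (4 * ω ^ 2 + 2 * b - 4) * ξ ^ 2 + 4 * b * ω * ξ + b ^ 2
        = (ξ - (-(1 / 4) * (lam₁ - lam₁⁻¹ - lam₂ + lam₂⁻¹) ^ 2))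
          * (ξ - (-(1 / 4) * (lam₁ + lam₁⁻¹ - lam₂ - lam₂⁻¹) ^ 2))
          * (ξ - (-(1 / 4) * (lam₁ - lam₁⁻¹ + lam₂ - lam₂⁻¹) ^ 2))
          * (ξ - (-(1 / 4) * (lam₁ + lam₁⁻¹ + lam₂ + lam₂⁻¹) ^ 2)) := by
  intro ξ
  have e₁ : lam₁ * lam₁⁻¹ = 1 := mul_inv_cancel₀ h₁
  have e₂ : lam₂ * lam₂⁻¹ = 1 := mul_inv_cancel₀ h₂
  generalize lam₁⁻¹ = y₁ at *
  generalize lam₂⁻¹ = y₂ at *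
  have hω' : ω = (lam₁ ^ 2 + y₁ ^ 2 + lam₂ ^ 2 + y₂ ^ 2) / 4 := by linear_combination hω / 4
  have hb' : b = (lam₁ ^ 2 + y₁ ^ 2 - (lam₂ ^ 2 + y₂ ^ 2)) ^ 2 / 16 := by
    rw [hω'] at hb
    linear_combination -hb / 4
  have pair (p q : ℂ) : (ξ - (-(1 / 4) * (p - q) ^ 2)) * (ξ - (-(1 / 4) * (p + q) ^ 2))
      = ξ ^ 2 + (p ^ 2 + q ^ 2) / 2 * ξ + (p ^ 2 - q ^ 2) ^ 2 / 16 := by ring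
  have sub₁ : (lam₁ - y₁) ^ 2 = lam₁ ^ 2 + y₁ ^ 2 - 2 := by linear_combination -2 * e₁
  have sub₂ : (lam₂ - y₂) ^ 2 = lam₂ ^ 2 + y₂ ^ 2 - 2 := by linear_combination -2 * e₂
  have add₁ : (lam₁ + y₁) ^ 2 = lam₁ ^ 2 + y₁ ^ 2 + 2 := by linear_combination 2 * e₁
  have add₂ : (lam₂ + y₂) ^ 2 = lam₂ ^ 2 + y₂ ^ 2 + 2 := by linear_combination 2 * e₂
  have minus := pair (lam₁ - y₁) (lam₂ - y₂)
  have plus := pair (lam₁ + y₁) (lam₂ + y₂)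
  rw [sub₁, sub₂] at minus
  rw [add₁, add₂] at plus
  have minus' : (ξ - (-(1 / 4) * (lam₁ - y₁ - lam₂ + y₂) ^ 2))
      * (ξ - (-(1 / 4) * (lam₁ - y₁ + lam₂ - y₂) ^ 2)) = ξ ^ 2 + 2 * ω * ξ + b - 2 * ξ := by
    rw [hb', hω']
    linear_combination minus
  have plus' : (ξ - (-(1 / 4) * (lam₁ + y₁ - lam₂ - y₂) ^ 2))
      * (ξ - (-(1 / 4) * (lam₁ + y₁ + lam₂ + y₂) ^ 2)) = ξ ^ 2 + 2 * ω * ξ + b + 2 * ξ := by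
    rw [hb', hω']
    linear_combination plus
  calc
    _ = (ξ ^ 2 + 2 * ω * ξ + b - 2 * ξ) * (ξ ^ 2 + 2 * ω * ξ + b + 2 * ξ) := by ring
    _ = _ := by
      rw [← minus', ← plus', mul_mul_mul_comm, ← mul_assoc]
end
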